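/- Let n ≥ 1, let k > ℓ ≥ 1 be integers, let s ≥ 1 be an integer, and let d = gcd(s, n). Let M denote the maximum over positive divisors e of d of μ_{k,ℓ}(ZMod e) · (n/e). If M ≥ ⌊n/(k+ℓ)⌋, then μ^{{0,s}}_{k,ℓ}(ZMod n) = M, where {0,s} is the image of {0, s} ⊆ ℤ in ZMod n. -/

import Mathlib

open Finset Pointwise

/-- The `k`-fold Minkowski sum `kA = A + ⋯ + A` (with `0A = {0}`). -/
def iterSum {n : ℕ} : ℕ → Finset (ZMod n) → Finset (ZMod n)
  | 0, _ => {0}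
  | j + 1, A => A + iterSum j A

/-- The noisy `k`-fold sum `k *_C A = kA + (k-1)C`. -/
def noisy {n : ℕ} (C : Finset (ZMod n)) (k : ℕ) (A : Finset (ZMod n)) :
    Finset (ZMod n) :=
  iterSum k A + iterSum (k - 1) C

/-- `A` is `C`-`(k,ℓ)`-sum-free: `(k *_C A) ∩ (ℓ *_C A) = ∅`. -/
def SumFree {n : ℕ} (C : Finset (ZMod n)) (k l : ℕ) (A : Finset (ZMod n)) : Prop :=
  noisy C k A ∩ noisy C l A = ∅

/-- `μ^C_{k,ℓ}(ZMod n)`: the maximum size of a `C`-`(k,ℓ)`-sum-free subset of `ZMod n`. -/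
noncomputable def mu (n : ℕ) (k l : ℕ) (C : Finset (ZMod n)) : ℕ :=
  sSup {m | ∃ A : Finset (ZMod n), SumFree C k l A ∧ A.card = m}

/-- The stabilizer `stab(X) = {g : g + X = X}` of a finite subset of `ZMod n`. -/
def stab {n : ℕ} (X : Finset (ZMod n)) : Set (ZMod n) :=
  {g | X.image (g + ·) = X}

section Kneser

variable {G : Type*} [AddCommGroup G]

/-- The subgroup `H` translates the finset `X` into itself. -/
def Stabilizes (H : AddSubgroup G) (X : Finset G) : Prop := ∀ h ∈ H, ∀ x ∈ X, h + x ∈ X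

section Decidable

variable [DecidableEq G]

theorem stabilizes_stabilizer (X : Finset G) : Stabilizes (AddAction.stabilizer G X) X := by
  intro h hh x hx
  have := vadd_mem_vadd_finset (a := h) hx
  rwa [AddAction.mem_stabilizer_iff.1 hh] at this

theorem Stabilizes.le_stabilizer {H : AddSubgroup G} {X : Finset G} (hX : Stabilizes H X) :
    H ≤ AddAction.stabilizer G X := by
  intro h hh
  refine AddAction.mem_stabilizer_iff.2 (eq_of_subset_of_card_le (fun z hz => ?_) (by simp))
  obtain ⟨u, hu, rfl⟩ := mem_vadd_finset.1 hz
  exact hX h hh u hu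

theorem list_sum_nonempty {L : List (Finset G)} (hL : ∀ A ∈ L, A.Nonempty) :
    L.sum.Nonempty := by
  induction L with
  | nil => simp
  | cons A L ih =>
    rw [List.sum_cons]
    exact (hL A (by simp)).add (ih fun B hB => hL B (by simp [hB]))

end Decidable

variable [Fintype G]

open Classical in
/-- The elements of a subgroup of a finite group, as a finset. -/
noncomputable def subgroupFinset (H : AddSubgroup G) : Finset G := univ.filter (· ∈ H)

@[simp]
theorem mem_subgroupFinset {H : AddSubgroup G} {x : G} : x ∈ subgroupFinset H ↔ x ∈ H := by
  simp [subgroupFinset]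

theorem card_le_of_add_mem {H : AddSubgroup G} {S : Finset G} (x : G)
    (hS : ∀ h ∈ H, h + x ∈ S) : #(subgroupFinset H) ≤ #S :=
  card_le_card_of_injOn (· + x) (fun h hh => hS h (by simpa using hh))
    (fun _ _ _ _ hab => add_right_cancel hab)

variable [DecidableEq G]

/-- Inside `x + H₁ + H₂`, the set `X` is a union of cosets of `H₁` and `Y` is a union of cosets of
`H₂`, so `Y \ X` contains a grid there. -/
theorem card_sdiff_grid {H₁ H₂ : AddSubgroup G} {X Y : Finset G} (hX : Stabilizes H₁ X)
    (hY : Stabilizes H₂ Y) (x : G) :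
    #{h ∈ subgroupFinset H₁ | h + x ∈ Y} * #{h ∈ subgroupFinset H₂ | h + x ∉ X} ≤
      #(subgroupFinset (H₁ ⊓ H₂)) * #(Y \ X) := by
  rw [← card_product]
  set P := {h ∈ subgroupFinset H₁ | h + x ∈ Y} ×ˢ {h ∈ subgroupFinset H₂ | h + x ∉ X}
  refine (card_le_mul_card_image (f := fun p : G × G => p.1 + p.2 + x) P
    #(subgroupFinset (H₁ ⊓ H₂)) ?_).trans (Nat.mul_le_mul_left _ (card_le_card ?_))
  · intro z hz
    obtain ⟨⟨a, b⟩, hab, rfl⟩ := mem_image.1 hz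
    simp only [P, mem_product, mem_filter, mem_subgroupFinset] at hab
    refine card_le_card_of_injOn (fun p => p.1 - a) ?_ ?_
    · rintro ⟨a', b'⟩ h
      simp only [P, coe_filter, Set.mem_ofPred_eq, mem_product, mem_filter,
        mem_subgroupFinset] at h
      have hsub : a' - a = b - b' := by
        have := add_right_cancel h.2
        rw [sub_eq_sub_iff_add_eq_add, this, add_comm]
      simp only [mem_coe, mem_subgroupFinset, AddSubgroup.mem_inf]
      exact ⟨H₁.sub_mem h.1.1.1 hab.1.1, hsub ▸ H₂.sub_mem hab.2.1 h.1.2.1⟩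
    · rintro ⟨a', b'⟩ h ⟨a'', b''⟩ h' heq
      simp only [coe_filter, Set.mem_ofPred_eq] at h h'
      have h₁ : a' = a'' := sub_left_injective heq
      have h₂ := h.2.trans h'.2.symm
      subst h₁
      simpa using h₂
  · intro z hz
    obtain ⟨⟨a, b⟩, hab, rfl⟩ := mem_image.1 hz
    simp only [P, mem_product, mem_filter, mem_subgroupFinset] at hab
    obtain ⟨⟨ha, hay⟩, hb, hbx⟩ := hab
    refine mem_sdiff.2 ⟨?_, fun hmem => hbx ?_⟩
    · have := hY b hb _ hay
      rwa [← add_assoc, add_comm b a] at this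
    · have := hX (-a) (H₁.neg_mem ha) _ hmem
      rwa [add_assoc a, neg_add_cancel_left] at this

theorem card_sdiff_alternatives {H₁ H₂ : AddSubgroup G} {X Y : Finset G} (hX : Stabilizes H₁ X)
    (hY : Stabilizes H₂ Y) {x : G} (hxY : x ∈ Y) (hxX : x ∉ X) :
    #(subgroupFinset H₁) ≤ #(Y \ X) + #(subgroupFinset (H₁ ⊓ H₂)) ∨
      #(subgroupFinset H₂) ≤ #(X \ Y) + #(subgroupFinset (H₁ ⊓ H₂)) ∨
      #(subgroupFinset H₂) ≤ #(Y \ X) := by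
  have hYX := card_sdiff_grid hX hY x
  have hXY := card_sdiff_grid hY hX x
  rw [inf_comm] at hXY
  set K := H₁ ⊓ H₂
  have hKpos : 0 < #(subgroupFinset K) := card_pos.2 ⟨0, by simp⟩
  have hp := card_filter_add_card_filter_not (s := subgroupFinset H₁) (fun h => h + x ∈ Y)
  have hq := card_filter_add_card_filter_not (s := subgroupFinset H₂) (fun h => h + x ∈ X)
  have card_le_of_coset : ∀ {S : Finset G} {a : G}, (∀ h ∈ K, h + a ∈ S) →
      #(subgroupFinset K) ≤ #S :=
    fun h => card_le_of_add_mem _ h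
  have hpK : #(subgroupFinset K) ≤ #{h ∈ subgroupFinset H₁ | h + x ∈ Y} := by
    refine card_le_of_coset (a := 0) fun h hh => ?_
    simpa using ⟨hh.1, hY h hh.2 x hxY⟩
  have hqK : #(subgroupFinset K) ≤ #{h ∈ subgroupFinset H₂ | h + x ∉ X} := by
    refine card_le_of_coset (a := 0) fun h hh => ?_
    simp only [add_zero, mem_filter, mem_subgroupFinset]
    refine ⟨hh.2, fun hc => hxX ?_⟩
    simpa using hX (-h) (H₁.neg_mem hh.1) _ hc
  have hp' : #{h ∈ subgroupFinset H₁ | h + x ∉ Y} = 0 ∨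
      #(subgroupFinset K) ≤ #{h ∈ subgroupFinset H₁ | h + x ∉ Y} := by
    rcases Finset.eq_empty_or_nonempty {h ∈ subgroupFinset H₁ | h + x ∉ Y} with he | ⟨a, ha⟩
    · exact Or.inl (by rw [he, card_empty])
    · refine Or.inr (card_le_of_coset (a := a) fun h hh => ?_)
      simp only [mem_filter, mem_subgroupFinset] at ha ⊢
      refine ⟨H₁.add_mem hh.1 ha.1, fun hc => ha.2 ?_⟩
      have := hY (-h) (H₂.neg_mem hh.2) _ hc
      rwa [add_assoc, neg_add_cancel_left] at this
  have hq' : #{h ∈ subgroupFinset H₂ | h + x ∈ X} = 0 ∨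
      #(subgroupFinset K) ≤ #{h ∈ subgroupFinset H₂ | h + x ∈ X} := by
    rcases Finset.eq_empty_or_nonempty {h ∈ subgroupFinset H₂ | h + x ∈ X} with he | ⟨a, ha⟩
    · exact Or.inl (by rw [he, card_empty])
    · refine Or.inr (card_le_of_coset (a := a) fun h hh => ?_)
      simp only [mem_filter, mem_subgroupFinset] at ha ⊢
      refine ⟨H₂.add_mem hh.2 ha.1, ?_⟩
      have := hX h hh.1 _ ha.2
      rwa [← add_assoc] at this
  generalize #{h ∈ subgroupFinset H₁ | h + x ∈ Y} = p at *
  generalize #{h ∈ subgroupFinset H₁ | h + x ∉ Y} = p' at *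
  generalize #{h ∈ subgroupFinset H₂ | h + x ∈ X} = q at *
  generalize #{h ∈ subgroupFinset H₂ | h + x ∉ X} = q' at *
  generalize #(subgroupFinset K) = c at *
  rw [← hp, ← hq]
  rcases hp' with rfl | hp'
  · left
    nlinarith [Nat.mul_le_mul_left p hqK]
  rcases hq' with rfl | hq'
  · right; right
    nlinarith [Nat.mul_le_mul_right q' hpK]
  by_contra! hcon
  obtain ⟨a, rfl⟩ := Nat.exists_eq_add_of_le hpK
  obtain ⟨b, rfl⟩ := Nat.exists_eq_add_of_le hqK
  obtain ⟨a', rfl⟩ := Nat.exists_eq_add_of_le hp'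
  obtain ⟨b', rfl⟩ := Nat.exists_eq_add_of_le hq'
  have h₁ : #(Y \ X) + 1 ≤ c + a + a' := by omega
  have h₂ : #(X \ Y) + 1 ≤ c + b + b' := by omega
  nlinarith [Nat.mul_le_mul_left c h₁, Nat.mul_le_mul_left c h₂, Nat.zero_le (a * b),
    Nat.zero_le (a' * b')]

theorem exists_stabilizes_union {m : ℕ} {X Y : Finset G}
    (hX : ∃ H : AddSubgroup G, Stabilizes H X ∧ m ≤ #X + #(subgroupFinset H))
    (hY : ∃ H : AddSubgroup G, Stabilizes H Y ∧ m ≤ #Y + #(subgroupFinset H)) :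
    ∃ H : AddSubgroup G, Stabilizes H (X ∪ Y) ∧ m ≤ #(X ∪ Y) + #(subgroupFinset H) := by
  by_cases hXY : X ⊆ Y
  · rwa [union_eq_right.2 hXY]
  by_cases hYX : Y ⊆ X
  · rwa [union_eq_left.2 hYX]
  obtain ⟨H₁, hX, hm₁⟩ := hX
  obtain ⟨H₂, hY, hm₂⟩ := hY
  obtain ⟨y, hyX, hyY⟩ := not_subset.1 hXY
  obtain ⟨x, hxY, hxX⟩ := not_subset.1 hYX
  refine ⟨H₁ ⊓ H₂, fun h hh z hz => ?_, ?_⟩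
  · rcases mem_union.1 hz with hz | hz
    · exact mem_union_left _ (hX h hh.1 z hz)
    · exact mem_union_right _ (hY h hh.2 z hz)
  · have h₁ := card_sdiff_alternatives hX hY hxY hxX
    have h₂ := card_sdiff_alternatives hY hX hyX hyY
    rw [inf_comm] at h₂
    have hc₁ := card_sdiff_add_card Y X
    have hc₂ := card_sdiff_add_card X Y
    rw [union_comm] at hc₁
    omega

theorem exists_stabilizes_mem_subset_add {A B : Finset G} {c : G} (hc : c ∈ A + B) :
    ∃ X ⊆ A + B, c ∈ X ∧
      ∃ H : AddSubgroup G, Stabilizes H X ∧ #A + #B ≤ #X + #(subgroupFinset H) := by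
  obtain ⟨a, ha, b, hb, rfl⟩ := mem_add.1 hc
  let S : Finset (Finset G × Finset G) := {p | a ∈ p.1 ∧ b ∈ p.2 ∧ p.1 + p.2 ⊆ A + B ∧
    #A + #B ≤ #p.1 + #p.2}
  obtain ⟨⟨A', B'⟩, hmem, hmax⟩ := exists_max_image S (fun p => #p.1) ⟨(A, B), by simp [S, ha, hb]⟩
  simp only [S, mem_filter, mem_univ, true_and] at hmem hmax
  obtain ⟨haA, hbB, hsub, hcard⟩ := hmem
  have key : ∀ e ∈ A', ∀ y ∈ B', e - b + y ∈ A' := by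
    intro e he
    set A'' := A' ∪ B'.image (e - b + ·) with hA''
    set B'' := {y ∈ B' | e - b + y ∈ A'} with hB''
    have himg : A' ∩ B'.image (e - b + ·) = B''.image (e - b + ·) := by
      ext z
      simp only [hB'', mem_inter, mem_image, mem_filter]
      constructor
      · rintro ⟨hz, y, hy, rfl⟩
        exact ⟨y, ⟨hy, hz⟩, rfl⟩
      · rintro ⟨y, ⟨hy, hz⟩, rfl⟩
        exact ⟨hz, y, hy, rfl⟩
    have hcards : #A'' + #B'' = #A' + #B' := by
      have h₁ := card_union_add_card_inter A' (B'.image (e - b + ·))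
      rwa [himg, card_image_of_injective _ (add_right_injective _),
        card_image_of_injective _ (add_right_injective _)] at h₁
    have hle := hmax (A'', B'') ⟨mem_union_left _ haA, by simp [hB'', hbB, he], ?_,
      hcards ▸ hcard⟩
    · have heq : A' = A'' := eq_of_subset_of_card_le subset_union_left hle
      intro y hy
      rw [heq]
      exact mem_union_right _ (mem_image_of_mem _ hy)
    · intro z hz
      obtain ⟨u, hu, v, hv, rfl⟩ := mem_add.1 hz
      obtain ⟨hv, hv'⟩ := mem_filter.1 hv
      rcases mem_union.1 hu with hu | hu
      · exact hsub (add_mem_add hu hv)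
      · obtain ⟨w, hw, rfl⟩ := mem_image.1 hu
        have := hsub (add_mem_add hv' hw)
        rwa [add_right_comm] at this
  refine ⟨A'.image (· + b), ?_, mem_image_of_mem _ haA,
    AddAction.stabilizer G A', ?_, ?_⟩
  · intro z hz
    obtain ⟨u, hu, rfl⟩ := mem_image.1 hz
    exact hsub (add_mem_add hu hbB)
  · intro h hh z hz
    obtain ⟨u, hu, rfl⟩ := mem_image.1 hz
    rw [← add_assoc]
    refine mem_image_of_mem _ ?_
    exact stabilizes_stabilizer A' h hh u hu
  · rw [card_image_of_injective _ (add_left_injective _)]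
    refine hcard.trans (Nat.add_le_add_left ?_ _)
    refine card_le_card_of_injOn (· - b) (fun y hy => ?_) (fun _ _ _ _ h => sub_left_injective h)
    simp only [mem_coe, mem_subgroupFinset, AddAction.mem_stabilizer_iff]
    refine eq_of_subset_of_card_le (fun z hz => ?_) (by simp)
    obtain ⟨u, hu, rfl⟩ := mem_vadd_finset.1 hz
    have := key u hu y hy
    rwa [vadd_eq_add, sub_add_eq_add_sub, add_comm y, ← sub_add_eq_add_sub]

/-- **Kneser's theorem** for two summands. -/
theorem exists_stabilizes_add {A B : Finset G} (hA : A.Nonempty) (hB : B.Nonempty) :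
    ∃ H : AddSubgroup G, Stabilizes H (A + B) ∧ #A + #B ≤ #(A + B) + #(subgroupFinset H) := by
  choose! X hXsub hXmem hX using fun c (hc : c ∈ A + B) => exists_stabilizes_mem_subset_add hc
  have hne := hA.add hB
  have hsup : (A + B).sup' hne X = A + B := by
    refine le_antisymm (sup'_le _ _ hXsub) fun c hc => ?_
    exact le_sup' X hc (hXmem c hc)
  have := sup'_induction hne X (p := fun Y => ∃ H : AddSubgroup G,
    Stabilizes H Y ∧ #A + #B ≤ #Y + #(subgroupFinset H))
    (fun _ h₁ _ h₂ => exists_stabilizes_union h₁ h₂) hX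
  rwa [hsup] at this

theorem Stabilizes.add_subgroupFinset {H : AddSubgroup G} {X : Finset G} (hX : Stabilizes H X) :
    X + subgroupFinset H = X := by
  refine Subset.antisymm (fun z hz => ?_) (subset_add_left X (by simp))
  obtain ⟨x, hx, h, hh, rfl⟩ := mem_add.1 hz
  rw [add_comm]
  exact hX h (by simpa using hh) x hx

theorem subgroupFinset_add_of_le {H K : AddSubgroup G} (h : K ≤ H) :
    subgroupFinset H + subgroupFinset K = subgroupFinset H :=
  Subset.antisymm (fun z hz => by
    obtain ⟨x, hx, y, hy, rfl⟩ := mem_add.1 hz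
    simp only [mem_subgroupFinset] at hx hy ⊢
    exact H.add_mem hx (h hy)) (subset_add_left _ (by simp))

theorem sum_map_add_subgroupFinset (H : AddSubgroup G) {L : List (Finset G)} (hL : L ≠ []) :
    (L.map (· + subgroupFinset H)).sum = L.sum + subgroupFinset H := by
  induction L with
  | nil => exact absurd rfl hL
  | cons A L ih =>
    rcases eq_or_ne L [] with rfl | hne
    · simp
    · rw [List.map_cons, List.sum_cons, ih hne, List.sum_cons, add_add_add_comm,
        subgroupFinset_add_of_le le_rfl]

/-- **Kneser's theorem** for finitely many summands. -/
theorem exists_stabilizes_list_sum {L : List (Finset G)} (hne : L ≠ [])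
    (hL : ∀ A ∈ L, A.Nonempty) :
    ∃ H : AddSubgroup G, Stabilizes H L.sum ∧
      (L.map fun A => #(A + subgroupFinset H)).sum + #(subgroupFinset H) ≤
        #L.sum + L.length * #(subgroupFinset H) := by
  induction hlen : L.length generalizing L with
  | zero => exact absurd (List.length_eq_zero_iff.1 hlen) hne
  | succ j ih =>
    obtain ⟨A, T, rfl⟩ := List.exists_cons_of_ne_nil hne
    rcases eq_or_ne T [] with rfl | hT
    · refine ⟨⊥, ?_, ?_⟩
      · intro h hh x hx
        rw [AddSubgroup.mem_bot.1 hh]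
        simpa using hx
      · have : subgroupFinset (⊥ : AddSubgroup G) = 0 := by ext; simp
        simp at hlen
        simp [this, ← hlen]
    set H := AddAction.stabilizer G (A :: T).sum with hH
    have hS := stabilizes_stabilizer (A :: T).sum
    rw [← hH] at hS
    have hTne := list_sum_nonempty fun B hB => hL B (List.mem_cons_of_mem _ hB)
    have hHne : (subgroupFinset H).Nonempty := ⟨0, by simp⟩
    have hsum : (A + subgroupFinset H) + (T.sum + subgroupFinset H) = (A :: T).sum := by
      rw [add_add_add_comm, subgroupFinset_add_of_le le_rfl, ← List.sum_cons,
        hS.add_subgroupFinset]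
    obtain ⟨K, hK, hKcard⟩ := exists_stabilizes_add ((hL A (by simp)).add hHne) (hTne.add hHne)
    rw [hsum] at hK hKcard
    have hKH : #(subgroupFinset K) ≤ #(subgroupFinset H) :=
      card_le_card fun x hx => mem_subgroupFinset.2 (hK.le_stabilizer (mem_subgroupFinset.1 hx))
    obtain ⟨K', hK', hK'card⟩ := ih (L := T.map (· + subgroupFinset H)) (by simpa using hT)
      (by
        intro B hB
        obtain ⟨B', hB', rfl⟩ := List.mem_map.1 hB
        exact (hL B' (List.mem_cons_of_mem _ hB')).add hHne)
      (by simpa using hlen)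
    rw [sum_map_add_subgroupFinset H hT] at hK' hK'card
    have hK'H : K' ≤ H := by
      refine Stabilizes.le_stabilizer fun h hh z hz => ?_
      rw [← hsum] at hz ⊢
      obtain ⟨u, hu, v, hv, rfl⟩ := mem_add.1 hz
      rw [add_left_comm h u v]
      exact add_mem_add hu (hK' h hh v hv)
    have hK'Hcard : #(subgroupFinset K') ≤ #(subgroupFinset H) :=
      card_le_card fun x hx => mem_subgroupFinset.2 (hK'H (mem_subgroupFinset.1 hx))
    refine ⟨H, hS, ?_⟩
    simp only [List.map_map, Function.comp_def, add_assoc, subgroupFinset_add_of_le hK'H]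
      at hK'card
    rw [List.map_cons, List.sum_cons]
    have hj : 1 ≤ j := by
      have := List.length_pos_iff.2 hT
      simp at hlen
      omega
    obtain ⟨i, rfl⟩ := Nat.exists_eq_add_of_le hj
    have := Nat.mul_le_mul_left i hK'Hcard
    nlinarith

end Kneser

theorem mu_set_bddAbove {n : ℕ} [NeZero n] (k l : ℕ) (C : Finset (ZMod n)) :
    BddAbove {m | ∃ A : Finset (ZMod n), SumFree C k l A ∧ A.card = m} := by
  refine ⟨n, ?_⟩
  rintro _ ⟨A, -, rfl⟩
  simpa using card_le_univ A

theorem SumFree.card_le_mu {n : ℕ} [NeZero n] {k l : ℕ} {C A : Finset (ZMod n)}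
    (hA : SumFree C k l A) : #A ≤ mu n k l C :=
  le_csSup (mu_set_bddAbove k l C) ⟨A, hA, rfl⟩

theorem iterSum_empty {n k : ℕ} (hk : k ≠ 0) : iterSum k (∅ : Finset (ZMod n)) = ∅ := by
  obtain ⟨j, rfl⟩ := Nat.exists_eq_succ_of_ne_zero hk
  simp [iterSum]

theorem exists_sumFree_card_eq_mu {n : ℕ} [NeZero n] {k l : ℕ} (hk : k ≠ 0)
    (C : Finset (ZMod n)) : ∃ A : Finset (ZMod n), SumFree C k l A ∧ #A = mu n k l C :=
  Nat.sSup_mem (s := {m | ∃ A : Finset (ZMod n), SumFree C k l A ∧ A.card = m})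
    ⟨0, ∅, by simp [SumFree, noisy, iterSum_empty hk], rfl⟩ (mu_set_bddAbove k l C)

theorem iterSum_singleton_zero {n : ℕ} (k : ℕ) : iterSum k ({0} : Finset (ZMod n)) = {0} := by
  induction k with
  | zero => rfl
  | succ j ih => simp [iterSum, ih]

theorem sumFree_singleton_zero_iff {n k l : ℕ} {A : Finset (ZMod n)} :
    SumFree {0} k l A ↔ Disjoint (iterSum k A) (iterSum l A) := by
  rw [SumFree, noisy, noisy, iterSum_singleton_zero, iterSum_singleton_zero, singleton_zero,
    add_zero, add_zero, disjoint_iff_inter_eq_empty]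

theorem image_iterSum {n e : ℕ} (f : ZMod n →+* ZMod e) (k : ℕ) (A : Finset (ZMod n)) :
    (iterSum k A).image f = iterSum k (A.image f) := by
  induction k with
  | zero => simp [iterSum]
  | succ j ih => rw [iterSum, image_add, ih, iterSum]

theorem iterSum_mono {n : ℕ} {A B : Finset (ZMod n)} (h : A ⊆ B) (k : ℕ) :
    iterSum k A ⊆ iterSum k B := by
  induction k with
  | zero => exact Subset.rfl
  | succ j ih => exact add_subset_add h ih

theorem zero_mem_iterSum {n : ℕ} {C : Finset (ZMod n)} (h : 0 ∈ C) (k : ℕ) :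
    0 ∈ iterSum k C :=
  iterSum_mono (singleton_subset_iff.2 h) k (by simp [iterSum_singleton_zero])

theorem iterSum_eq_sum_replicate {n : ℕ} (k : ℕ) (A : Finset (ZMod n)) :
    iterSum k A = (List.replicate k A).sum := by
  induction k with
  | zero => rfl
  | succ j ih => rw [iterSum, ih, List.replicate_succ, List.sum_cons]

theorem neg_iterSum {n : ℕ} (k : ℕ) (A : Finset (ZMod n)) :
    -iterSum k A = iterSum k (-A) := by
  induction k with
  | zero => simp [iterSum]
  | succ j ih => rw [iterSum, neg_add, ih, iterSum]

theorem card_castHom_fiber {n e : ℕ} [NeZero n] [NeZero e] (he : e ∣ n) (y : ZMod e) :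
    #{x : ZMod n | ZMod.castHom he (ZMod e) x = y} = n / e := by
  have hsurj := ZMod.castHom_surjective he
  have hconst : ∀ z : ZMod e, #{x : ZMod n | ZMod.castHom he (ZMod e) x = z} =
      #{x : ZMod n | ZMod.castHom he (ZMod e) x = y} := fun z =>
    AddMonoidHom.card_fiber_eq_of_mem_range (ZMod.castHom he (ZMod e)) (hsurj z) (hsurj y)
  have hsum := card_eq_sum_card_fiberwise (s := univ) (t := univ)
    (f := ZMod.castHom he (ZMod e)) (by simp)
  rw [sum_congr rfl fun z _ => hconst z] at hsum
  simp only [card_univ, ZMod.card, sum_const, smul_eq_mul] at hsum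
  exact (Nat.div_eq_of_eq_mul_right (NeZero.pos e) hsum).symm

theorem mu_mul_le_mu {n e k l s : ℕ} [NeZero n] [NeZero e] (hk : k ≠ 0) (he : e ∣ n)
    (hes : e ∣ s) :
    mu e k l ({0} : Finset (ZMod e)) * (n / e) ≤ mu n k l ({0, (s : ZMod n)}) := by
  obtain ⟨B, hB, hcard⟩ := exists_sumFree_card_eq_mu (n := e) (l := l) hk {0}
  set f := ZMod.castHom he (ZMod e)
  set A : Finset (ZMod n) := {x | f x ∈ B}
  have hAB : A.image f ⊆ B := by
    intro y hy
    obtain ⟨x, hx, rfl⟩ := mem_image.1 hy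
    exact (mem_filter.1 hx).2
  have hAcard : #A = #B * (n / e) := by
    rw [card_eq_sum_card_fiberwise (s := A) (t := B) (f := f)
      fun x hx => (mem_filter.1 hx).2]
    rw [sum_congr rfl (g := fun _ => n / e), sum_const, smul_eq_mul]
    intro y hy
    rw [← card_castHom_fiber he y]
    congr 1
    ext x
    simp only [A, mem_filter, mem_univ, true_and]
    exact ⟨fun h => h.2, fun h => ⟨h ▸ hy, h⟩⟩
  have hC : ({0, (s : ZMod n)} : Finset (ZMod n)).image f = {0} := by
    have hfs : f (s : ZMod n) = 0 := by
      rw [map_natCast]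
      exact (ZMod.natCast_eq_zero_iff s e).2 hes
    simp [image_insert, hfs]
  have hnoisy : ∀ j, (noisy ({0, (s : ZMod n)}) j A).image f ⊆ iterSum j B := by
    intro j
    rw [noisy, image_add, image_iterSum, image_iterSum, hC, iterSum_singleton_zero,
      singleton_zero, add_zero]
    exact iterSum_mono hAB j
  rw [← hcard, ← hAcard]
  refine SumFree.card_le_mu (disjoint_iff_inter_eq_empty.1 (disjoint_left.2 fun x hx hx' => ?_))
  exact disjoint_left.1 (sumFree_singleton_zero_iff.1 hB) (hnoisy k (mem_image_of_mem f hx))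
    (hnoisy l (mem_image_of_mem f hx'))

theorem ker_castHom_index {n : ℕ} [NeZero n] (H : AddSubgroup (ZMod n)) (he : H.index ∣ n)
    (x : ZMod n) : ZMod.castHom he (ZMod H.index) x = 0 ↔ x ∈ H := by
  have : NeZero H.index := ⟨AddSubgroup.index_ne_zero_of_finite⟩
  set f := (ZMod.castHom he (ZMod H.index)).toAddMonoidHom
  have hker : f.ker = H := by
    refine AddSubgroup.eq_of_le_of_card_ge (fun y hy => ?_) ?_
    · have hy0 : ((y.val : ℕ) : ZMod H.index) = 0 := by
        have : ZMod.castHom he (ZMod H.index) ((y.val : ℕ) : ZMod n) = 0 := by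
          rw [ZMod.natCast_zmod_val]
          exact hy
        rwa [map_natCast] at this
      obtain ⟨c, hc⟩ := (ZMod.natCast_eq_zero_iff _ _).1 hy0
      have hyc : y = H.index • (c : ZMod n) := by
        rw [nsmul_eq_mul, ← Nat.cast_mul, ← hc, ZMod.natCast_zmod_val]
      rw [hyc]
      exact H.nsmul_index_mem _
    · have h₁ := H.card_mul_index
      have h₂ := f.ker.card_mul_index
      have hsurj : Function.Surjective f := ZMod.castHom_surjective he
      rw [AddSubgroup.index_ker, AddMonoidHom.range_eq_top.2 hsurj, AddSubgroup.card_top,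
        Nat.card_zmod H.index, ← h₁] at h₂
      exact (Nat.eq_of_mul_eq_mul_right (NeZero.pos H.index) h₂).ge
  exact (AddMonoidHom.mem_ker (f := f)).symm.trans (by rw [hker])

/-- A set whose difference set `kA - ℓA` avoids the subgroup `H` is controlled by `(k, ℓ)`-sum-free
sets modulo `H`. -/
theorem card_le_mu_index_mul {n k l : ℕ} [NeZero n] (H : AddSubgroup (ZMod n))
    {A : Finset (ZMod n)} (hA : ∀ x ∈ iterSum k A, ∀ y ∈ iterSum l A, x - y ∉ H) :
    #A ≤ mu H.index k l ({0} : Finset (ZMod H.index)) * (n / H.index) := by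
  have : NeZero H.index := ⟨AddSubgroup.index_ne_zero_of_finite⟩
  have he : H.index ∣ n := by simpa using H.index_dvd_card
  set f := ZMod.castHom he (ZMod H.index) with hf
  have hB : SumFree {0} k l (A.image f) := by
    rw [sumFree_singleton_zero_iff, ← image_iterSum, ← image_iterSum, disjoint_left]
    intro z hz hz'
    obtain ⟨x, hx, rfl⟩ := mem_image.1 hz
    obtain ⟨y, hy, hxy⟩ := mem_image.1 hz'
    refine hA x hx y hy ((ker_castHom_index H he _).1 ?_)
    rw [map_sub, ← hf, hxy, sub_self]
  calc #A ≤ n / H.index * #(A.image f) := by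
        refine card_le_mul_card_image A _ fun y _ => ?_
        rw [← card_castHom_fiber he y]
        exact card_le_card (filter_subset_filter _ (subset_univ A))
    _ ≤ mu H.index k l ({0} : Finset (ZMod H.index)) * (n / H.index) := by
        rw [mul_comm]
        exact Nat.mul_le_mul_right _ hB.card_le_mu

theorem two_mul_card_le_card_pair_add {G : Type*} [AddCommGroup G] [Fintype G] [DecidableEq G]
    {H : AddSubgroup G} {c : G} (hc : c ∉ H) :
    2 * #(subgroupFinset H) ≤ #(({0, c} : Finset G) + subgroupFinset H) := by
  have hdisj : Disjoint (subgroupFinset H) ((subgroupFinset H).image (c + ·)) := by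
    refine disjoint_left.2 fun x hx hx' => hc ?_
    obtain ⟨y, hy, rfl⟩ := mem_image.1 hx'
    simp only [mem_subgroupFinset] at hx hy
    simpa using H.sub_mem hx hy
  have hcard := card_union_of_disjoint hdisj
  rw [card_image_of_injective _ (add_right_injective c), ← two_mul] at hcard
  rw [← hcard]
  refine card_le_card (union_subset (subset_add_right _ (by simp)) fun z hz => ?_)
  obtain ⟨y, hy, rfl⟩ := mem_image.1 hz
  exact add_mem_add (by simp) hy

/-- A `{0, c}`-`(k, ℓ)`-sum-free set is either small or periodic modulo a subgroup containing
`c`. -/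
theorem SumFree.card_mul_le_or_exists_subgroup {n k l : ℕ} [NeZero n] (hl : 1 ≤ l)
    (hkl : l < k) {c : ZMod n} {A : Finset (ZMod n)} (hA : SumFree {0, c} k l A) :
    (k + l) * #A ≤ n ∨ ∃ H : AddSubgroup (ZMod n), c ∈ H ∧
      ∀ x ∈ iterSum k A, ∀ y ∈ iterSum l A, x - y ∉ H := by
  rcases A.eq_empty_or_nonempty with rfl | hne
  · simp
  set C : Finset (ZMod n) := {0, c} with hC
  set L := List.replicate k A ++ List.replicate (k - 1) C ++
    (List.replicate l (-A) ++ List.replicate (l - 1) (-C)) with hLdef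
  have hsum : L.sum = noisy C k A + -noisy C l A := by
    simp only [hLdef, List.sum_append, ← iterSum_eq_sum_replicate, noisy, neg_add, neg_iterSum]
  have hzero : (0 : ZMod n) ∉ L.sum := by
    rw [hsum]
    intro h0
    obtain ⟨x, hx, y, hy, hxy⟩ := mem_add.1 h0
    rw [add_eq_zero_iff_eq_neg.1 hxy] at hx
    exact disjoint_left.1 (disjoint_iff_inter_eq_empty.2 hA) hx (mem_neg'.1 hy)
  have hLne : L ≠ [] := by
    simp only [hLdef, ne_eq, List.append_eq_nil_iff, List.replicate_eq_nil_iff]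
    omega
  have hCne : C.Nonempty := ⟨0, by simp [hC]⟩
  obtain ⟨H, hH, hcard⟩ := exists_stabilizes_list_sum hLne (fun B hB => by
    simp only [hLdef, List.mem_append, List.mem_replicate] at hB
    rcases hB with (⟨-, rfl⟩ | ⟨-, rfl⟩) | ⟨-, rfl⟩ | ⟨-, rfl⟩
    exacts [hne, hCne, hne.neg, hCne.neg])
  have hdisj : ∀ x ∈ L.sum, x ∉ H := fun x hx hxH => hzero (by
    simpa using hH (-x) (H.neg_mem hxH) x hx)
  by_cases hcH : c ∈ H
  · refine Or.inr ⟨H, hcH, fun x hx y hy => hdisj _ ?_⟩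
    have hC0 : ∀ j, (0 : ZMod n) ∈ iterSum j C := zero_mem_iterSum (by simp [hC])
    rw [hsum, sub_eq_add_neg]
    exact add_mem_add (subset_add_left _ (hC0 _) hx)
      (neg_mem_neg (subset_add_left _ (hC0 _) hy))
  · left
    have hn : #L.sum + #(subgroupFinset H) ≤ n := by
      rw [← card_union_of_disjoint (disjoint_left.2 fun x hx hx' =>
        hdisj x hx (mem_subgroupFinset.1 hx'))]
      simpa using card_le_univ (L.sum ∪ subgroupFinset H)
    have hAH : ∀ B : Finset (ZMod n), #B ≤ #(B + subgroupFinset H) := fun B =>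
      card_le_card (subset_add_left B (by simp))
    have hA₁ := hAH A
    have hA₂ := hAH (-A)
    rw [card_neg] at hA₂
    have hC₁ : 2 * #(subgroupFinset H) ≤ #(C + subgroupFinset H) :=
      two_mul_card_le_card_pair_add hcH
    have hC₂ : 2 * #(subgroupFinset H) ≤ #(-C + subgroupFinset H) := by
      have : -C = {0, -c} := by
        ext x
        simp [hC]
      rw [this]
      exact two_mul_card_le_card_pair_add fun h => hcH (by simpa using H.neg_mem h)
    simp only [hLdef, List.map_append, List.map_replicate, List.sum_append, List.sum_replicate,
      smul_eq_mul, List.length_append, List.length_replicate] at hcard hn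
    obtain ⟨i, rfl⟩ := Nat.exists_eq_add_of_le' hl
    obtain ⟨j, rfl⟩ := Nat.exists_eq_add_of_le' (hl.trans hkl.le)
    simp only [Nat.add_sub_cancel] at hcard hn
    nlinarith [Nat.mul_le_mul_left (j + 1) hA₁, Nat.mul_le_mul_left (i + 1) hA₂,
      Nat.mul_le_mul_left j hC₁, Nat.mul_le_mul_left i hC₂]

theorem stmt13 (n : ℕ) [NeZero n] (k l s : ℕ) (hl : 1 ≤ l) (hkl : l < k) (hs : 1 ≤ s)
    (d : ℕ) (hd : d = Nat.gcd s n)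
    (M : ℕ) (hM : M = d.divisors.sup fun e => mu e k l ({0} : Finset (ZMod e)) * (n / e))
    (h : n / (k + l) ≤ M) :
    mu n k l ({0, (s : ZMod n)} : Finset (ZMod n)) = M := by
  have hk : k ≠ 0 := by omega
  have hd0 : d ≠ 0 := by
    rw [hd]
    exact Nat.gcd_ne_zero_right (NeZero.ne n)
  apply le_antisymm
  · obtain ⟨A, hA, hcard⟩ := exists_sumFree_card_eq_mu (l := l) hk ({0, (s : ZMod n)})
    rw [← hcard]
    rcases hA.card_mul_le_or_exists_subgroup hl hkl with hle | ⟨H, hsH, hH⟩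
    · exact ((Nat.le_div_iff_mul_le (by omega)).2 (by rwa [mul_comm])).trans h
    · have he : H.index ∣ n := by simpa using H.index_dvd_card
      have hes : H.index ∣ s := by
        rwa [← ker_castHom_index H he, map_natCast, ZMod.natCast_eq_zero_iff] at hsH
      rw [hM]
      exact (card_le_mu_index_mul H hH).trans
        (le_sup (f := fun e => mu e k l ({0} : Finset (ZMod e)) * (n / e))
          (Nat.mem_divisors.2 ⟨hd ▸ Nat.dvd_gcd hes he, hd0⟩))
  · rw [hM]
    refine Finset.sup_le fun e he => ?_
    have hed := Nat.dvd_of_mem_divisors he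
    rw [hd] at hed
    have : NeZero e := ⟨(Nat.pos_of_mem_divisors he).ne'⟩
    exact mu_mul_le_mu hk (hed.trans (Nat.gcd_dvd_right s n)) (hed.trans (Nat.gcd_dvd_left s n))
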